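/- (IHT-like identification, Lemma 6.) Let Φ ∈ ℝ^{m×N}, let S ⊆ {1,…,N} with |S| ≤ s, let x ∈ ℝ^N, e′ ∈ ℝ^m, and set y = Φx_S + e′. Suppose Φ satisfies the RIP of order 3s with constant δ₃ and the RIP of order 2s with constant δ₂, and let μ ≥ 0. Let u ∈ ℝ^N be s-sparse and let S″ be a set of indices of the s largest magnitude entries of u + μΦ*(y − Φu). Then ‖(x_S)_{complement of S″}‖₂ ≤ √2·(|μ−1| + μδ₃)·‖x_S − u‖₂ + √(2(1+δ₂))·μ·‖e′‖₂. -/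

import Mathlib

open Matrix Finset

/-- The Euclidean norm of a vector in `ℝⁿ`. -/
noncomputable def norm2 {n : ℕ} (v : Fin n → ℝ) : ℝ := Real.sqrt (∑ i, (v i) ^ 2)

/-- The support of a vector: the set of indices of its nonzero entries. -/
noncomputable def supp {n : ℕ} (v : Fin n → ℝ) : Finset (Fin n) :=
  Finset.univ.filter (fun i => v i ≠ 0)

/-- `restrict v T` keeps the entries of `v` with indices in `T` and sets all others to zero. -/
def restrict {n : ℕ} (v : Fin n → ℝ) (T : Finset (Fin n)) : Fin n → ℝ :=
  fun i => if i ∈ T then v i else 0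

/-- `Φ` satisfies the restricted isometry property of order `t` with constant `δ`. -/
def RIP (m N : ℕ) (Φ : Matrix (Fin m) (Fin N) ℝ) (t : ℕ) (δ : ℝ) : Prop :=
  ∀ v : Fin N → ℝ, (supp v).card ≤ t →
    (1 - δ) * (norm2 v) ^ 2 ≤ (norm2 (Φ.mulVec v)) ^ 2 ∧
    (norm2 (Φ.mulVec v)) ^ 2 ≤ (1 + δ) * (norm2 v) ^ 2

/-- `z` is a least-squares solution over support `T` for data `y`. -/
def IsLeastSquares {m N : ℕ} (Φ : Matrix (Fin m) (Fin N) ℝ) (y : Fin m → ℝ)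
    (T : Finset (Fin N)) (z : Fin N → ℝ) : Prop :=
  supp z ⊆ T ∧ ∀ w : Fin N → ℝ, supp w ⊆ T →
    norm2 (y - Φ.mulVec z) ≤ norm2 (y - Φ.mulVec w)

/-- `U` is a set of indices of the `k` largest magnitude entries of `v`. -/
def IsLargest {n : ℕ} (v : Fin n → ℝ) (k : ℕ) (U : Finset (Fin n)) : Prop :=
  U.card = k ∧ ∀ i ∈ U, ∀ j ∉ U, |v j| ≤ |v i|


theorem norm2_nonneg {n : ℕ} (v : Fin n → ℝ) : 0 ≤ norm2 v := Real.sqrt_nonneg _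

theorem norm2_sq {n : ℕ} (v : Fin n → ℝ) : norm2 v ^ 2 = v ⬝ᵥ v := by
  unfold norm2
  rw [Real.sq_sqrt (Finset.sum_nonneg fun i _ => sq_nonneg _)]
  simp [dotProduct, pow_two]

theorem norm2_eq_zero {n : ℕ} (v : Fin n → ℝ) (h : norm2 v = 0) : v = 0 := by
  have := norm2_sq v
  rw [h] at this
  exact dotProduct_self_eq_zero.mp (by simpa using this.symm)

theorem cs {n : ℕ} (a b : Fin n → ℝ) : |a ⬝ᵥ b| ≤ norm2 a * norm2 b := by
  apply abs_le_of_sq_le_sq _ (mul_nonneg (norm2_nonneg a) (norm2_nonneg b))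
  rw [mul_pow, norm2_sq, norm2_sq]
  have := Finset.sum_mul_sq_le_sq_mul_sq Finset.univ a b
  simpa [dotProduct, pow_two] using this

theorem supp_sub {n : ℕ} (v : Fin n → ℝ) (R : Finset (Fin n)) (h : ∀ i, i ∉ R → v i = 0) :
    supp v ⊆ R := by
  intro i hi
  by_contra hc
  simp [supp] at hi
  exact hi (h i hc)

theorem polar {m N : ℕ} (Φ : Matrix (Fin m) (Fin N) ℝ) (t : ℕ) (δ : ℝ) (h : RIP m N Φ t δ)
    (R : Finset (Fin N)) (hR : R.card ≤ t) (a b : Fin N → ℝ)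
    (ha : ∀ i, i ∉ R → a i = 0) (hb : ∀ i, i ∉ R → b i = 0) :
    (Φ.mulVec a) ⬝ᵥ (Φ.mulVec b) - a ⬝ᵥ b ≤ δ * (norm2 a * norm2 b) := by
  have key : ∀ p q : ℝ, 2 * (p * q) * ((Φ.mulVec a) ⬝ᵥ (Φ.mulVec b) - a ⬝ᵥ b) ≤
      δ * (p ^ 2 * norm2 a ^ 2 + q ^ 2 * norm2 b ^ 2) := by
    intro p q
    have h1 := (h (p • a + q • b) ((Finset.card_le_card (supp_sub _ R
      (fun i hi => by simp [ha i hi, hb i hi]))).trans hR)).2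
    have h2 := (h (p • a - q • b) ((Finset.card_le_card (supp_sub _ R
      (fun i hi => by simp [ha i hi, hb i hi]))).trans hR)).1
    simp only [norm2_sq, mulVec_add, mulVec_sub, mulVec_smul, dotProduct_add, add_dotProduct,
      dotProduct_sub, sub_dotProduct, smul_dotProduct, dotProduct_smul, smul_eq_mul] at h1 h2 ⊢
    rw [dotProduct_comm (Φ.mulVec b) (Φ.mulVec a), dotProduct_comm b a] at h1 h2
    nlinarith
  rcases (norm2_nonneg a).eq_or_lt with h0 | h0
  · rw [norm2_eq_zero a h0.symm]; simp [norm2]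
  rcases (norm2_nonneg b).eq_or_lt with h1 | h1
  · rw [norm2_eq_zero b h1.symm]; simp [norm2]
  have := key (norm2 b) (norm2 a)
  have hp := mul_pos h0 h1
  by_contra hc
  push Not at hc
  have := mul_lt_mul_of_pos_left hc hp
  nlinarith

theorem sum_cmp {n : ℕ} (A B : Finset (Fin n)) (f : Fin n → ℝ) (hf : ∀ i, 0 ≤ f i)
    (hc : A.card ≤ B.card) (h : ∀ i ∈ A, ∀ j ∈ B, f i ≤ f j) :
    ∑ i ∈ A, f i ≤ ∑ j ∈ B, f j := by
  rcases B.eq_empty_or_nonempty with hB | hB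
  · subst hB
    have : A = ∅ := by simpa using hc
    simp [this]
  obtain ⟨b, hb, hm⟩ := B.exists_min_image f hB
  have h1 := Finset.sum_le_card_nsmul A f (f b) (fun i hi => h i hi b hb)
  have h2 := Finset.card_nsmul_le_sum B f (f b) hm
  refine h1.trans (le_trans ?_ h2)
  simp only [nsmul_eq_mul]
  exact mul_le_mul_of_nonneg_right (by exact_mod_cast hc) (hf b)

theorem norm2_restrict_sq {n : ℕ} (v : Fin n → ℝ) (T : Finset (Fin n)) :
    norm2 (restrict v T) ^ 2 = ∑ i ∈ T, v i ^ 2 := by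
  rw [norm2_sq]
  simp [dotProduct, _root_.restrict, pow_two, Finset.sum_ite_mem]

theorem norm2_sub_le {n : ℕ} (a b : Fin n → ℝ) : norm2 (a - b) ≤ norm2 a + norm2 b := by
  apply (fun h1 h2 => (abs_le_of_sq_le_sq h1 h2).trans' (le_abs_self _)) _ (add_nonneg (norm2_nonneg a) (norm2_nonneg b))
  have := (abs_le.mp (cs a b)).1
  have e : norm2 (a - b) ^ 2 = norm2 a ^ 2 - 2 * (a ⬝ᵥ b) + norm2 b ^ 2 := by
    simp only [norm2_sq, sub_dotProduct, dotProduct_sub, dotProduct_comm b a]; ring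
  nlinarith

theorem stmt_8 {m N : ℕ} (Φ : Matrix (Fin m) (Fin N) ℝ) (s : ℕ)
    (S : Finset (Fin N)) (hS : S.card ≤ s)
    (x : Fin N → ℝ) (e' : Fin m → ℝ) (y : Fin m → ℝ)
    (hy : y = Φ.mulVec (restrict x S) + e')
    (δ₃ δ₂ μ : ℝ) (hδ₃0 : 0 ≤ δ₃) (hδ₃1 : δ₃ ≤ 1) (hδ₂0 : 0 ≤ δ₂) (hδ₂1 : δ₂ ≤ 1)
    (hμ : 0 ≤ μ)
    (hRIP3 : RIP m N Φ (3 * s) δ₃) (hRIP2 : RIP m N Φ (2 * s) δ₂)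
    (u : Fin N → ℝ) (hu : (supp u).card ≤ s)
    (S'' : Finset (Fin N))
    (hS'' : IsLargest (fun i => u i + μ * (Φᵀ.mulVec (y - Φ.mulVec u)) i) s S'') :
    norm2 (restrict (restrict x S) S''ᶜ) ≤
      Real.sqrt 2 * (|μ - 1| + μ * δ₃) * norm2 (restrict x S - u) +
        Real.sqrt (2 * (1 + δ₂)) * μ * norm2 e' := by
  obtain ⟨hcard, hlarge⟩ := hS''
  set d := restrict x S - u with hd
  set w : Fin N → ℝ := fun i => u i + μ * (Φᵀ.mulVec (y - Φ.mulVec u)) i with hw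
  set h : Fin N → ℝ := w - restrict x S with hh
  have hwv : h = μ • Φᵀ.mulVec (Φ.mulVec d) + μ • Φᵀ.mulVec e' - d := by
    have e1 : y - Φ.mulVec u = Φ.mulVec d + e' := by
      rw [hy, hd, mulVec_sub]; abel
    ext i
    simp only [hh, hw, e1, mulVec_add, Pi.add_apply, Pi.sub_apply, Pi.smul_apply, smul_eq_mul, hd]
    ring
  set A := S \ S'' with hA
  set B := S'' \ S with hB
  have hAB : Disjoint A B := by
    rw [Finset.disjoint_left]; intro i; simp only [hA, hB, Finset.mem_sdiff]; tauto
  have hcAB : A.card ≤ B.card := by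
    have h1 := Finset.card_sdiff_add_card_inter S S''
    have h2 := Finset.card_sdiff_add_card_inter S'' S
    rw [Finset.inter_comm S'' S] at h2
    rw [hA, hB]
    omega
  set g := restrict h (A ∪ B) with hg
  have hgsq : norm2 g ^ 2 = g ⬝ᵥ h := by
    rw [hg, norm2_restrict_sq]
    simp [-Finset.mem_union, dotProduct, _root_.restrict, pow_two, Finset.sum_ite_mem]
  have hgR : ∀ i, i ∉ A ∪ B → g i = 0 := by
    intro i hi; simp only [hg, _root_.restrict, if_neg hi]
  have hsubST : A ∪ B ⊆ S ∪ S'' := by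
    intro i; simp only [hA, hB, Finset.mem_union, Finset.mem_sdiff]; tauto
  have hcST : (S ∪ S'').card ≤ 2 * s := (Finset.card_union_le _ _).trans (by omega)
  have hcR : ((S ∪ S'') ∪ supp u).card ≤ 3 * s := (Finset.card_union_le _ _).trans (by omega)
  have hpol := polar Φ (3 * s) δ₃ hRIP3 _ hcR g d
    (fun i hi => hgR i (fun hc => hi (Finset.mem_union_left _ (hsubST hc))))
    (fun i hi => by
      simp only [Finset.mem_union, not_or, supp, Finset.mem_filter, Finset.mem_univ, true_and,
        not_not] at hi
      simp [hd, _root_.restrict, hi.1.1, hi.2])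
  have hΦg : norm2 (Φ.mulVec g) ≤ Real.sqrt (1 + δ₂) * norm2 g := by
    have h1 := (hRIP2 g ((Finset.card_le_card ((supp_sub _ _ hgR).trans hsubST)).trans hcST)).2
    have h2 := Real.sqrt_le_sqrt h1
    rwa [Real.sqrt_sq (norm2_nonneg _), Real.sqrt_mul (by linarith),
      Real.sqrt_sq (norm2_nonneg _)] at h2
  have hadj : ∀ z : Fin m → ℝ, g ⬝ᵥ Φᵀ.mulVec z = Φ.mulVec g ⬝ᵥ z := by
    intro z; rw [dotProduct_mulVec, vecMul_transpose]
  set K := (|μ - 1| + μ * δ₃) * norm2 d + Real.sqrt (1 + δ₂) * μ * norm2 e' with hK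
  have hK0 : 0 ≤ K := by
    have := norm2_nonneg d
    have := norm2_nonneg e'
    positivity
  have hgK : norm2 g ≤ K := by
    have e2 : norm2 g ^ 2 = μ * (Φ.mulVec g ⬝ᵥ Φ.mulVec d - g ⬝ᵥ d) + (μ - 1) * (g ⬝ᵥ d)
        + μ * (Φ.mulVec g ⬝ᵥ e') := by
      rw [hgsq, hwv, dotProduct_sub, dotProduct_add, dotProduct_smul, dotProduct_smul, hadj, hadj,
        smul_eq_mul, smul_eq_mul]
      ring
    have t1 := mul_le_mul_of_nonneg_left hpol hμ
    have t2 : (μ - 1) * (g ⬝ᵥ d) ≤ |μ - 1| * (norm2 g * norm2 d) := by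
      refine (le_abs_self _).trans ?_
      rw [abs_mul]
      exact mul_le_mul_of_nonneg_left (cs g d) (abs_nonneg _)
    have t3 : Φ.mulVec g ⬝ᵥ e' ≤ Real.sqrt (1 + δ₂) * norm2 g * norm2 e' :=
      ((le_abs_self _).trans (cs _ _)).trans
        (mul_le_mul_of_nonneg_right hΦg (norm2_nonneg _))
    have t4 := mul_le_mul_of_nonneg_left t3 hμ
    have t5 : norm2 g * norm2 g ≤ norm2 g * K := by
      rw [hK]; nlinarith
    rcases (norm2_nonneg g).eq_or_lt with h0 | h0
    · rw [← h0]; exact hK0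
    · exact le_of_mul_le_mul_left t5 h0
  have hsplit : norm2 g ^ 2 = norm2 (restrict h A) ^ 2 + norm2 (restrict h B) ^ 2 := by
    rw [hg, norm2_restrict_sq, norm2_restrict_sq, norm2_restrict_sq, Finset.sum_union hAB]
  have hwAB : norm2 (restrict w A) ≤ norm2 (restrict h B) := by
    refine (le_abs_self _).trans (abs_le_of_sq_le_sq ?_ (norm2_nonneg _))
    rw [norm2_restrict_sq, norm2_restrict_sq]
    have : ∑ i ∈ B, h i ^ 2 = ∑ i ∈ B, w i ^ 2 := by
      refine Finset.sum_congr rfl fun i hi => ?_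
      have : i ∉ S := (Finset.mem_sdiff.mp hi).2
      simp [hh, _root_.restrict, this]
    rw [this]
    refine sum_cmp A B (fun i => w i ^ 2) (fun i => sq_nonneg _) hcAB ?_
    intro i hi j hj
    exact sq_le_sq.mpr (hlarge j (Finset.mem_sdiff.mp hj).1 i (Finset.mem_sdiff.mp hi).2)
  have hxA : restrict (restrict x S) S''ᶜ = restrict w A - restrict h A := by
    ext i
    by_cases h1 : i ∈ S <;> by_cases h2 : i ∈ S'' <;> simp [_root_.restrict, hA, hh, h1, h2]
  have hfin : norm2 (restrict h B) + norm2 (restrict h A) ≤ Real.sqrt 2 * norm2 g := by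
    refine (le_abs_self _).trans (abs_le_of_sq_le_sq ?_
      (mul_nonneg (Real.sqrt_nonneg _) (norm2_nonneg _)))
    rw [mul_pow, Real.sq_sqrt (by norm_num), hsplit]
    nlinarith [sq_nonneg (norm2 (restrict h B) - norm2 (restrict h A))]
  have h1 := norm2_sub_le (restrict w A) (restrict h A)
  have h2 := mul_le_mul_of_nonneg_left hgK (Real.sqrt_nonneg 2)
  rw [hxA, Real.sqrt_mul (by norm_num)]
  calc _ ≤ Real.sqrt 2 * K := by linarith
    _ = _ := by rw [hK]; ring
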